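/- Let P = ⟨A | R⟩ be any finite presentation. There is a constant C > 1, depending only on P, such that for every null-homotopic word w and every L: if the length-one sequence (w) can be converted to a sequence of empty words by free reductions, free expansions, applications of relators, cyclic conjugations and fragmentations with the total length of every intermediate sequence at most L, then w is equal in the free group on A to a product of at most C^L conjugates of elements of R ∪ R⁻¹. In particular Area(w) ≤ C^{FFFL(w)}. -/

import Mathlib

/-! Words over an alphabet `A`: a letter `(x, true)` is the generator `x`,
and `(x, false)` is its formal inverse `x⁻¹`. -/

/-- A word over the alphabet `A ∪ A⁻¹`. -/
abbrev Word (A : Type*) := List (A × Bool)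

namespace Word

/-- The formal inverse of a word. -/
def inv {A : Type*} (w : Word A) : Word A := (w.map fun p => (p.1, !p.2)).reverse

/-- `w'` is a cyclic conjugate (cyclic permutation) of `w`. -/
def IsCyclicConj {A : Type*} (w w' : Word A) : Prop :=
  ∃ u v : Word A, w = u ++ v ∧ w' = v ++ u

end Word

/-- Moves (i)–(iii) on words with respect to a set `R` of relator words:
free reduction, free expansion, and application of a relator (replace a subword `u`
by `v` where some cyclic conjugate of `u * v⁻¹` lies in `R ∪ R⁻¹`). -/
inductive Move {A : Type*} (R : Set (Word A)) : Word A → Word A → Prop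
  | freeReduce (u v : Word A) (x : A) (b : Bool) :
      Move R (u ++ (x, b) :: (x, !b) :: v) (u ++ v)
  | freeExpand (u v : Word A) (x : A) (b : Bool) :
      Move R (u ++ v) (u ++ (x, b) :: (x, !b) :: v)
  | relator (p q u v z : Word A)
      (hz : Word.IsCyclicConj (u ++ Word.inv v) z) (hR : z ∈ R ∨ Word.inv z ∈ R) :
      Move R (p ++ u ++ q) (p ++ v ++ q)

/-- Moves (i)–(iv): moves (i)–(iii) together with cyclic conjugation. -/
inductive MoveC {A : Type*} (R : Set (Word A)) : Word A → Word A → Prop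
  | of {w w' : Word A} : Move R w w' → MoveC R w w'
  | cyc {w w' : Word A} : Word.IsCyclicConj w w' → MoveC R w w'

/-- Moves (i)–(v) on finite sequences of words: one of the moves (i)–(iv) applied to
one word of the sequence, or fragmentation of one word `u ++ v` into `u` and `v`. -/
inductive MoveF {A : Type*} (R : Set (Word A)) : List (Word A) → List (Word A) → Prop
  | of (l₁ l₂ : List (Word A)) {w w' : Word A} :
      MoveC R w w' → MoveF R (l₁ ++ w :: l₂) (l₁ ++ w' :: l₂)
  | frag (l₁ l₂ : List (Word A)) (u v : Word A) :
      MoveF R (l₁ ++ (u ++ v) :: l₂) (l₁ ++ u :: v :: l₂)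

/-- A word is null-homotopic over the presentation with relator set `R` if it represents
the identity of the presented group, i.e. lies in the normal closure of the relators. -/
def NullHomotopic {A : Type*} (R : Set (Word A)) (w : Word A) : Prop :=
  FreeGroup.mk w ∈ Subgroup.normalClosure (FreeGroup.mk '' R)

/-- `FLle R w L`: the word `w` can be converted to the empty word by moves (i)–(iii)
with every intermediate word of length at most `L`. -/
def FLle {A : Type*} (R : Set (Word A)) (w : Word A) (L : ℕ) : Prop :=
  ∃ (m : ℕ) (f : ℕ → Word A), f 0 = w ∧ f m = [] ∧
    (∀ i < m, Move R (f i) (f (i + 1))) ∧ ∀ i ≤ m, (f i).length ≤ L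

/-- `FFLle R w L`: the word `w` can be converted to the empty word by moves (i)–(iv)
with every intermediate word of length at most `L`. -/
def FFLle {A : Type*} (R : Set (Word A)) (w : Word A) (L : ℕ) : Prop :=
  ∃ (m : ℕ) (f : ℕ → Word A), f 0 = w ∧ f m = [] ∧
    (∀ i < m, MoveC R (f i) (f (i + 1))) ∧ ∀ i ≤ m, (f i).length ≤ L

/-- The total length of a finite sequence of words. -/
def totalLength {A : Type*} (l : List (Word A)) : ℕ := (l.map List.length).sum

/-- `FFFLle R w L`: the length-one sequence `(w)` can be converted to a sequence of empty
words by moves (i)–(v) with every intermediate sequence of total length at most `L`. -/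
def FFFLle {A : Type*} (R : Set (Word A)) (w : Word A) (L : ℕ) : Prop :=
  ∃ (m : ℕ) (f : ℕ → List (Word A)), f 0 = [w] ∧ (∀ u ∈ f m, u = ([] : Word A)) ∧
    (∀ i < m, MoveF R (f i) (f (i + 1))) ∧ ∀ i ≤ m, totalLength (f i) ≤ L

/-- An element `x` of the free group is a conjugate of a relator of `R` or of an inverse
of a relator. -/
def IsConjRelator {A : Type*} (R : Set (Word A)) (x : FreeGroup A) : Prop :=
  ∃ c ρ : FreeGroup A, (ρ ∈ FreeGroup.mk '' R ∨ ρ⁻¹ ∈ FreeGroup.mk '' R) ∧ x = c * ρ * c⁻¹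

/-- `AreaLe R g N`: in the free group, `g` is a product of at most `N` conjugates
of elements of `R ∪ R⁻¹`. -/
def AreaLe {A : Type*} (R : Set (Word A)) (g : FreeGroup A) (N : ℕ) : Prop :=
  ∃ l : List (FreeGroup A), l.length ≤ N ∧ (∀ x ∈ l, IsConjRelator R x) ∧ l.prod = g

/-- The number of occurrences in `w` of the letter `x` or its inverse. -/
def countLtr {A : Type*} [DecidableEq A] (x : A) (w : Word A) : ℕ :=
  (w.filter fun p => p.1 = x).length

/-- The filling length `FL(w)` of a null-homotopic word. -/
noncomputable def FLw {A : Type*} (R : Set (Word A)) (w : Word A) : ℕ :=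
  sInf {L | FLle R w L}

/-- The free filling length `FFL(w)` of a null-homotopic word. -/
noncomputable def FFLw {A : Type*} (R : Set (Word A)) (w : Word A) : ℕ :=
  sInf {L | FFLle R w L}

/-- The fragmenting free filling length `FFFL(w)` of a null-homotopic word. -/
noncomputable def FFFLw {A : Type*} (R : Set (Word A)) (w : Word A) : ℕ :=
  sInf {L | FFFLle R w L}

/-- The filling length function `FL : ℕ → ℕ` of the presentation with relators `R`. -/
noncomputable def FLfn {A : Type*} (R : Set (Word A)) (n : ℕ) : ℕ :=
  sSup (FLw R '' {w | NullHomotopic R w ∧ w.length ≤ n})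

/-- The free filling length function `FFL : ℕ → ℕ`. -/
noncomputable def FFLfn {A : Type*} (R : Set (Word A)) (n : ℕ) : ℕ :=
  sSup (FFLw R '' {w | NullHomotopic R w ∧ w.length ≤ n})

/-- The fragmenting free filling length function `FFFL : ℕ → ℕ`. -/
noncomputable def FFFLfn {A : Type*} (R : Set (Word A)) (n : ℕ) : ℕ :=
  sSup (FFFLw R '' {w | NullHomotopic R w ∧ w.length ≤ n})

/-! The presentation `Q = ⟨a, b, r, s, t | a^b a⁻², [t,a], [r,at], [r,s], [s,t]⟩`. -/

/-- The five generators of the presentation `Q`. -/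
inductive QGen | a | b | r | s | t
deriving DecidableEq

/-- The five relators of `Q`: `b⁻¹aba⁻¹a⁻¹`, `t⁻¹a⁻¹ta`, `r⁻¹t⁻¹a⁻¹rat`,
`r⁻¹s⁻¹rs`, `s⁻¹t⁻¹st`. -/
def QRels : Set (Word QGen) :=
  { [(QGen.b, false), (QGen.a, true), (QGen.b, true), (QGen.a, false), (QGen.a, false)],
    [(QGen.t, false), (QGen.a, false), (QGen.t, true), (QGen.a, true)],
    [(QGen.r, false), (QGen.t, false), (QGen.a, false), (QGen.r, true), (QGen.a, true),
      (QGen.t, true)],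
    [(QGen.r, false), (QGen.s, false), (QGen.r, true), (QGen.s, true)],
    [(QGen.s, false), (QGen.t, false), (QGen.s, true), (QGen.t, true)] }

/-- The word `bⁿ`. -/
def bpow (n : ℕ) : Word QGen := List.replicate n (QGen.b, true)

/-- The word `b⁻ⁿ`. -/
def bpowInv (n : ℕ) : Word QGen := List.replicate n (QGen.b, false)

/-- The word `a^{-bⁿ} = b⁻ⁿ a⁻¹ bⁿ`. -/
def aConjNeg (n : ℕ) : Word QGen := bpowInv n ++ [(QGen.a, false)] ++ bpow n

/-- The word `a^{bⁿ} = b⁻ⁿ a bⁿ`. -/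
def aConjPos (n : ℕ) : Word QGen := bpowInv n ++ [(QGen.a, true)] ++ bpow n

/-- The word `a^{-bⁿ} r a^{bⁿ}`. -/
def gword (n : ℕ) : Word QGen := aConjNeg n ++ [(QGen.r, true)] ++ aConjPos n

/-- The word `w_n = [s, a^{-bⁿ} r a^{bⁿ}] = s⁻¹ (b⁻ⁿa⁻¹bⁿ r b⁻ⁿabⁿ)⁻¹ s (b⁻ⁿa⁻¹bⁿ r b⁻ⁿabⁿ)`. -/
def wn (n : ℕ) : Word QGen :=
  [(QGen.s, false)] ++ Word.inv (gword n) ++ [(QGen.s, true)] ++ gword n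

/-- The word `a^{-bⁿ} r a^{bⁿ} r a^{bⁿ} r⁻¹ a^{-bⁿ}`. -/
def g'word (n : ℕ) : Word QGen :=
  aConjNeg n ++ [(QGen.r, true)] ++ aConjPos n ++ [(QGen.r, true)] ++ aConjPos n ++
    [(QGen.r, false)] ++ aConjNeg n

/-- The word `w'_n = [s, a^{-bⁿ} r a^{bⁿ} r a^{bⁿ} r⁻¹ a^{-bⁿ}]`. -/
def w'n (n : ℕ) : Word QGen :=
  [(QGen.s, false)] ++ Word.inv (g'word n) ++ [(QGen.s, true)] ++ g'word n

/-- The area of an element of the free group, `⊤` if it is not in the normal closure of `R`. -/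
noncomputable def freeArea {A : Type*} (R : Set (Word A)) (g : FreeGroup A) : ℕ∞ :=
  sInf ((fun N : ℕ => (N : ℕ∞)) '' {N | AreaLe R g N})

/-- The sum of the areas of the terms of a sequence of words. -/
noncomputable def seqArea {A : Type*} (R : Set (Word A)) (l : List (Word A)) : ℕ∞ :=
  (l.map fun w => freeArea R (FreeGroup.mk w)).sum

section Area

variable {A : Type*} {R : Set (Word A)}

theorem freeArea_le_iff {g : FreeGroup A} {N : ℕ} : freeArea R g ≤ N ↔ AreaLe R g N := by
  constructor
  · intro h
    rcases Set.eq_empty_or_nonempty ((fun N : ℕ => (N : ℕ∞)) '' {N | AreaLe R g N}) with he | hne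
    · rw [freeArea, he, sInf_empty] at h
      exact absurd h (by simp)
    · obtain ⟨M, ⟨l, hl, hc, hp⟩, hM⟩ := csInf_mem hne
      have hMN : (M : ℕ∞) ≤ N := hM.trans_le h
      exact ⟨l, hl.trans (by exact_mod_cast hMN), hc, hp⟩
  · exact fun h => sInf_le ⟨N, h, rfl⟩

theorem freeArea_one : freeArea R 1 = 0 := by
  have h : freeArea R 1 ≤ (0 : ℕ) := freeArea_le_iff.2 ⟨[], by simp, by simp, by simp⟩
  simpa using h

theorem IsConjRelator.freeArea_le {g : FreeGroup A} (h : IsConjRelator R g) :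
    freeArea R g ≤ 1 := by
  have h' : freeArea R g ≤ (1 : ℕ) := freeArea_le_iff.2 ⟨[g], by simp, by simpa using h, by simp⟩
  simpa using h'

theorem IsConjRelator.conj {g : FreeGroup A} (h : IsConjRelator R g) (c : FreeGroup A) :
    IsConjRelator R (c * g * c⁻¹) := by
  obtain ⟨d, ρ, hρ, rfl⟩ := h
  exact ⟨c * d, ρ, hρ, by group⟩

theorem freeArea_mul_le (g h : FreeGroup A) :
    freeArea R (g * h) ≤ freeArea R g + freeArea R h := by
  rcases eq_or_ne (freeArea R g) ⊤ with hg | hg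
  · simp [hg]
  rcases eq_or_ne (freeArea R h) ⊤ with hh | hh
  · simp [hh]
  obtain ⟨M, hM⟩ := ENat.ne_top_iff_exists.1 hg
  obtain ⟨N, hN⟩ := ENat.ne_top_iff_exists.1 hh
  obtain ⟨l, hl, hlc, hlp⟩ := freeArea_le_iff.1 hM.symm.le
  obtain ⟨k, hk, hkc, hkp⟩ := freeArea_le_iff.1 hN.symm.le
  rw [← hM, ← hN, ← Nat.cast_add, freeArea_le_iff]
  refine ⟨l ++ k, by simp; omega, fun x hx => ?_, by simp [hlp, hkp]⟩
  exact (List.mem_append.1 hx).elim (hlc x) (hkc x)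

theorem freeArea_conj_le (c g : FreeGroup A) : freeArea R (c * g * c⁻¹) ≤ freeArea R g := by
  rcases eq_or_ne (freeArea R g) ⊤ with hg | hg
  · simp [hg]
  obtain ⟨M, hM⟩ := ENat.ne_top_iff_exists.1 hg
  obtain ⟨l, hl, hlc, hlp⟩ := freeArea_le_iff.1 hM.symm.le
  rw [← hM, freeArea_le_iff]
  refine ⟨l.map (MulAut.conj c), by simpa using hl, fun x hx => ?_, ?_⟩
  · obtain ⟨y, hy, rfl⟩ := List.mem_map.1 hx
    simpa using (hlc y hy).conj c
  · rw [← map_list_prod, hlp, MulAut.conj_apply]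

theorem MoveC.freeArea_le {w w' : Word A} (h : MoveC R w w') :
    freeArea R (FreeGroup.mk w) ≤ freeArea R (FreeGroup.mk w') + 1 := by
  have hred (u v : Word A) (x : A) (b : Bool) :
      FreeGroup.mk (u ++ (x, b) :: (x, !b) :: v) = FreeGroup.mk (u ++ v) :=
    Quot.sound FreeGroup.Red.Step.not
  cases h with
  | of h =>
    cases h with
    | freeReduce u v x b =>
      rw [hred u v x b]
      exact le_self_add
    | freeExpand u v x b =>
      rw [hred u v x b]
      exact le_self_add
    | relator p q u v z hz hzR =>
      obtain ⟨s, t, hst, rfl⟩ := hz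
      have hinv (y : Word A) : FreeGroup.mk (Word.inv y) = (FreeGroup.mk y)⁻¹ := rfl
      have huv : FreeGroup.mk u * (FreeGroup.mk v)⁻¹ = FreeGroup.mk s * FreeGroup.mk t := by
        rw [← hinv, FreeGroup.mul_mk, FreeGroup.mul_mk, hst]
      have hc : IsConjRelator R (FreeGroup.mk (p ++ s) * FreeGroup.mk (t ++ s) *
          (FreeGroup.mk (p ++ s))⁻¹) :=
        ⟨_, _, hzR.imp (Set.mem_image_of_mem _) (fun h => ⟨_, h, hinv _⟩), rfl⟩
      have heq : FreeGroup.mk (p ++ u ++ q) = FreeGroup.mk (p ++ s) * FreeGroup.mk (t ++ s) *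
          (FreeGroup.mk (p ++ s))⁻¹ * FreeGroup.mk (p ++ v ++ q) := by
        simp only [← FreeGroup.mul_mk]
        rw [eq_mul_of_mul_inv_eq huv]
        group
      rw [heq, add_comm]
      exact (freeArea_mul_le _ _).trans (by gcongr; exact hc.freeArea_le)
  | cyc h =>
    obtain ⟨u, v, rfl, rfl⟩ := h
    have heq : FreeGroup.mk (u ++ v) =
        FreeGroup.mk u * FreeGroup.mk (v ++ u) * (FreeGroup.mk u)⁻¹ := by
      simp only [← FreeGroup.mul_mk]
      group
    rw [heq]
    exact (freeArea_conj_le _ _).trans le_self_add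

theorem MoveF.seqArea_le {l l' : List (Word A)} (h : MoveF R l l') :
    seqArea R l ≤ seqArea R l' + 1 := by
  cases h with
  | of l₁ l₂ h =>
    simp only [seqArea, List.map_append, List.map_cons, List.sum_append, List.sum_cons]
    rw [add_assoc _ _ (1 : ℕ∞), add_right_comm _ _ (1 : ℕ∞)]
    gcongr
    exact h.freeArea_le
  | frag l₁ l₂ u v =>
    simp only [seqArea, List.map_append, List.map_cons, List.sum_append, List.sum_cons]
    refine le_trans ?_ le_self_add
    rw [← FreeGroup.mul_mk, ← add_assoc (freeArea R (FreeGroup.mk u))]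
    gcongr
    exact freeArea_mul_le _ _

theorem seqArea_filter_ne_nil (l : List (Word A)) :
    seqArea R (l.filter fun w => !w.isEmpty) = seqArea R l := by
  induction l with
  | nil => rfl
  | cons w l ih =>
    cases w with
    | nil =>
      have h : freeArea R (FreeGroup.mk ([] : Word A)) = 0 := freeArea_one
      simpa [seqArea, h] using ih
    | cons x w => simpa [seqArea] using congrArg (freeArea R (FreeGroup.mk (x :: w)) + ·) ih

end Area

theorem totalLength_filter_le {A : Type*} (p : Word A → Bool) (l : List (Word A)) :
    totalLength (l.filter p) ≤ totalLength l :=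
  (List.filter_sublist.map _).sum_le_sum (by simp)

/-- There are at most exponentially many sequences of non-empty words of given total length. -/
theorem exists_finset_of_totalLength_le (A : Type*) [Finite A] (L : ℕ) :
    ∃ F : Finset (List (Word A)), F.card ≤ (4 * Nat.card A + 2) ^ L ∧
      ∀ l : List (Word A), (∀ w ∈ l, w ≠ []) → totalLength l ≤ L → l ∈ F := by
  classical
  have := Fintype.ofFinite A
  induction L with
  | zero =>
    refine ⟨{[]}, by simp, fun l hl hL => ?_⟩
    cases l with
    | nil => simp
    | cons w l =>
      have hw := List.length_pos_iff.2 (hl w (by simp))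
      simp only [totalLength, List.map_cons, List.sum_cons] at hL
      omega
  | succ L ih =>
    obtain ⟨F, hF, hmem⟩ := ih
    let F₁ := (Finset.univ ×ˢ F).image fun y : (A × Bool) × List (Word A) => [y.1] :: y.2
    let F₂ := (Finset.univ ×ˢ F).image fun y : (A × Bool) × List (Word A) =>
      y.2.modifyHead (y.1 :: ·)
    refine ⟨{[]} ∪ (F₁ ∪ F₂), ?_, fun l hl hL => ?_⟩
    · have h₁ : F₁.card ≤ 2 * Nat.card A * F.card := by
        refine Finset.card_image_le.trans ?_
        simp [mul_comm]
      have h₂ : F₂.card ≤ 2 * Nat.card A * F.card := by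
        refine Finset.card_image_le.trans ?_
        simp [mul_comm]
      have h₃ := Finset.card_union_le {[]} (F₁ ∪ F₂)
      have h₄ := Finset.card_union_le F₁ F₂
      have h₅ : 0 < (4 * Nat.card A + 2) ^ L := by positivity
      rw [Finset.card_singleton] at h₃
      rw [pow_succ]
      nlinarith [Nat.mul_le_mul_left (Nat.card A) hF]
    · rcases l with _ | ⟨_ | ⟨x, _ | ⟨y, w⟩⟩, l⟩
      · simp
      · simp at hl
      · have h : l ∈ F := hmem l (fun w hw => hl w (by simp [hw])) (by
          simp only [totalLength, List.map_cons, List.sum_cons, List.length_cons] at hL ⊢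
          omega)
        have h' : [x] :: l ∈ F₁ := Finset.mem_image.2 ⟨(x, l), by simp [h], rfl⟩
        simp [h']
      · have h : (y :: w) :: l ∈ F := hmem _ (by simpa using fun v hv => hl v (by simp [hv])) (by
          simp only [totalLength, List.map_cons, List.sum_cons, List.length_cons] at hL ⊢
          omega)
        have h' : (x :: y :: w) :: l ∈ F₂ :=
          Finset.mem_image.2 ⟨(x, (y :: w) :: l), by simp [h], rfl⟩
        simp [h']

/-- A discrete intermediate value theorem for sequences that decrease by at most one at a time. -/
theorem exists_eq_of_le_add_one (m : ℕ) (g : ℕ → ℕ∞) (hg : ∀ i < m, g i ≤ g (i + 1) + 1)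
    (hm : g m = 0) (k : ℕ) (hk : k ≤ g 0) : ∃ i ≤ m, g i = k := by
  induction m generalizing g with
  | zero => exact ⟨0, le_rfl, le_antisymm (by simp [hm]) hk⟩
  | succ m ih =>
    rcases hk.eq_or_lt with h | h
    · exact ⟨0, by simp, h.symm⟩
    · obtain ⟨i, hi, hik⟩ := ih (fun i => g (i + 1)) (fun i hi => hg (i + 1) (by omega)) hm
        (ENat.lt_add_one_iff' (ENat.natCast_ne_top k) |>.1 (h.trans_le (hg 0 (by simp))))
      exact ⟨i + 1, by omega, hik⟩

theorem area_le_exp_FFFL {A : Type*} [Finite A] (R : Set (Word A)) (hR : R.Finite) :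
    ∃ C : ℕ, 1 < C ∧ ∀ (w : Word A) (L : ℕ), NullHomotopic R w →
      FFFLle R w L → AreaLe R (FreeGroup.mk w) (C ^ L) := by
  classical
  refine ⟨4 * Nat.card A + 2, by omega, fun w L _ ⟨m, f, h0, hm, hstep, hlen⟩ => ?_⟩
  obtain ⟨F, hF, hmem⟩ := exists_finset_of_totalLength_le A L
  have hfm : seqArea R (f m) = 0 := by
    rw [← seqArea_filter_ne_nil, List.filter_eq_nil_iff.2 fun u hu => by simp [hm u hu]]
    rfl
  have hf0 : seqArea R (f 0) = freeArea R (FreeGroup.mk w) := by simp [h0, seqArea]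
  rw [← freeArea_le_iff, ← hf0]
  by_contra! hlt
  have hsub : (Finset.range ((4 * Nat.card A + 2) ^ L + 1)).image (fun k : ℕ => (k : ℕ∞)) ⊆
      F.image (seqArea R) := by
    intro x hx
    obtain ⟨k, hk, rfl⟩ := Finset.mem_image.1 hx
    have hk' : (k : ℕ∞) ≤ seqArea R (f 0) :=
      le_trans (by exact_mod_cast Finset.mem_range_succ_iff.1 hk) hlt.le
    obtain ⟨i, hi, hik⟩ := exists_eq_of_le_add_one m (fun i => seqArea R (f i))
      (fun i hi => (hstep i hi).seqArea_le) hfm k hk'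
    refine Finset.mem_image.2 ⟨(f i).filter fun w => !w.isEmpty, hmem _ (by simp) ?_, ?_⟩
    · exact (totalLength_filter_le _ _).trans (hlen i hi)
    · rw [seqArea_filter_ne_nil, hik]
  have hcard := (Finset.card_le_card hsub).trans Finset.card_image_le
  rw [Finset.card_image_of_injective _ Nat.cast_injective, Finset.card_range] at hcard
  omega
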